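/- arXiv:1706.04569 — 2 statements merged into one kernel-verified Lean document; each statement's English description precedes it below -/
import Mathlib

section
/- Suppose d > 0, n ∈ [2,3], and c ∈ [1.55, n). Then for each i = 1, 2, 3, the function μᵢ attains a unique global minimum on (Q_*, 1) at a point Qᵢ ∈ (Q_*, 1). Moreover: (a) Q₁ = (c/n)^{1/(n−1)}; (b) Q₂ < Q₁ and μ₁(Q₂) = μ₂(Q₂); (c) μ₃(Q₃) < μ₁(Q₁) < μ₂(Q₂) < 0. -/
open Set Filter Topology intervalIntegral Real

noncomputable section

/-- The rescaled traveling-wave ODE for the magma equation at a point `r`. -/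
def magmaODE (d n c : ℝ) (Q : ℝ → ℝ) (r : ℝ) : Prop :=
  -deriv Q r + (1 / c) * deriv (fun s => Q s ^ n) r
    + deriv (fun s => Q s ^ n * deriv (deriv Q) s) r
    + (d - 1) * Q r ^ n * deriv (fun s => deriv Q s / s) r = 0

/-- Solution of the IVP on `[0, σ]`. -/
def isIVPSolutionOn (d n c μ : ℝ) (Q : ℝ → ℝ) (σ : ℝ) : Prop :=
  ContDiffOn ℝ 3 Q (Icc 0 σ) ∧ (∀ r ∈ Ioo (0:ℝ) σ, magmaODE d n c Q r) ∧
    Q 0 = 1 ∧ deriv Q 0 = 0 ∧ deriv (deriv Q) 0 = μ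

/-- Solution of the IVP on `[0, ∞)`. -/
def isIVPSolution (d n c μ : ℝ) (Q : ℝ → ℝ) : Prop :=
  ContDiffOn ℝ 3 Q (Ici 0) ∧ (∀ r : ℝ, 0 < r → magmaODE d n c Q r) ∧
    Q 0 = 1 ∧ deriv Q 0 = 0 ∧ deriv (deriv Q) 0 = μ

def F1 (d n c : ℝ) (Q μ : ℝ) : ℝ :=
  -(1 / (n - 1)) * (Q ^ (1 - n) - 1) - (n / c) * Real.log Q + μ * d

def F2 (d n c : ℝ) (Q μ : ℝ) : ℝ :=
  ∫ q in (1:ℝ)..Q, F1 d n c q μ * q ^ n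

def F3 (d n c : ℝ) (Q μ : ℝ) : ℝ :=
  F1 d n c Q μ - n * ∫ q in (1:ℝ)..Q, F2 d n c q μ * q ^ (-(n + 2))

def mu1 (d n c Q : ℝ) : ℝ := -(F1 d n c Q 0) / (F1 d n c Q 1 - F1 d n c Q 0)
def mu2 (d n c Q : ℝ) : ℝ := -(F2 d n c Q 0) / (F2 d n c Q 1 - F2 d n c Q 0)
def mu3 (d n c Q : ℝ) : ℝ := -(F3 d n c Q 0) / (F3 d n c Q 1 - F3 d n c Q 0)

def h3ex (d n Q : ℝ) : ℝ :=
  d * (1 - n * Real.log Q / (n + 1) - n / (n + 1) ^ 2 * (Q ^ (-(n + 1)) - 1))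

def setA (d n c Qs : ℝ) : Set ℝ :=
  {μ : ℝ | μ < 0 ∧ ∃ (Q : ℝ → ℝ) (σ rs : ℝ), 0 < rs ∧ rs < σ ∧
    isIVPSolutionOn d n c μ Q σ ∧ (∀ r ∈ Ioc (0:ℝ) σ, 0 < Q r ∧ deriv Q r < 0) ∧
    Q rs = Qs}

lemma exp_le_one_add_cubic {x : ℝ} (h0 : 0 ≤ x) (h1 : x ≤ 1) :
    exp x ≤ 1 + x + x ^ 2 / 2 + 2 / 9 * x ^ 3 := by
  have h := Real.exp_bound' h0 h1 (n := 3) (by norm_num)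
  simp only [Finset.sum_range_succ, Finset.sum_range_zero, Nat.factorial] at h
  norm_num at h
  linarith

lemma quartic_le_exp {x : ℝ} (hx : |x| ≤ 1) :
    1 + x + x ^ 2 / 2 + x ^ 3 / 6 - 5 / 96 * x ^ 4 ≤ exp x := by
  have h := Real.exp_bound hx (n := 4) (by norm_num)
  simp only [Finset.sum_range_succ, Finset.sum_range_zero, Nat.factorial] at h
  have h4 : |x| ^ 4 = x ^ 4 := by rw [← abs_pow]; exact abs_of_nonneg (by positivity)
  rw [h4] at h
  have := (abs_le.1 h).1
  norm_num at this
  linarith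

/-- Affine lower bound for the solution `ℓ` of `exp ℓ - 1 - ℓ = (v + 3)² / (v + 2)`. -/
lemma affine_le_of_exp_eq {v l : ℝ} (h0 : 0 ≤ v) (h1 : v ≤ 1) (hl : 0 < l)
    (h : exp l - 1 - l = (v + 3) ^ 2 / (v + 2)) : 2.015 + 0.115 * v ≤ l := by
  by_contra! hlt
  set a := 2.015 + 0.115 * v with ha
  have e1 : exp l + (a - l) ≤ exp a := by
    have h1 : exp a = exp l * exp (a - l) := by rw [← exp_add]; congr 1; ring
    have h2 := add_one_le_exp (a - l)
    have h3 : 1 ≤ exp l := one_le_exp hl.le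
    nlinarith
  have e2 : exp a ≤ 7.3891 * (1 + (a - 2) + (a - 2) ^ 2 / 2 + 2 / 9 * (a - 2) ^ 3) := by
    have h1 : exp a = exp 1 * exp 1 * exp (a - 2) := by
      rw [← exp_add, ← exp_add]; congr 1; ring
    have h2 := exp_le_one_add_cubic (x := a - 2) (by linarith) (by linarith)
    have h3 : exp 1 * exp 1 ≤ 7.3891 := by nlinarith [exp_one_lt_d9, exp_pos 1]
    rw [h1]
    gcongr
  have e3 : (v + 3) ^ 2 / (v + 2) ≤ 7.3891 * (1 + (a - 2) + (a - 2) ^ 2 / 2 + 2 / 9 * (a - 2) ^ 3) - 1 - a := by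
    linarith
  rw [div_le_iff₀ (by linarith), ha] at e3
  have hB : ∀ i j : ℕ, 0 ≤ v ^ i * (1 - v) ^ j := fun i j =>
    mul_nonneg (pow_nonneg h0 i) (pow_nonneg (sub_nonneg.2 h1) j)
  linarith [hB 0 4, hB 1 3, hB 2 2, hB 3 1, hB 4 0]

lemma affine_le_exp_mul {v : ℝ} (h0 : 0 ≤ v) (h1 : v ≤ 1) :
    1.94 + 0.9555 * v ≤ exp ((2.015 + 0.115 * v) * ((v + 1) / (v + 3))) := by
  set w : ℝ := -0.3308 + 0.4743 * v - 0.0796 * v ^ 2 with hw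
  have hv : 0 ≤ v * (1 - v) := mul_nonneg h0 (sub_nonneg.2 h1)
  have hB : ∀ i j : ℕ, 0 ≤ v ^ i * (1 - v) ^ j := fun i j =>
    mul_nonneg (pow_nonneg h0 i) (pow_nonneg (sub_nonneg.2 h1) j)
  have hle : 1 + w ≤ (2.015 + 0.115 * v) * ((v + 1) / (v + 3)) := by
    rw [mul_div_assoc', le_div_iff₀ (by linarith), hw]
    nlinarith [mul_nonneg h0 (sq_nonneg (v - 0.8)), mul_nonneg h0 (sq_nonneg (v - 0.75)),
      mul_nonneg (sub_nonneg.2 h1) (sq_nonneg (v - 0.75)),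
      mul_nonneg (sub_nonneg.2 h1) (sq_nonneg (v - 0.8))]
  have hb := quartic_le_exp (x := w) (abs_le.2 ⟨by nlinarith, by nlinarith⟩)
  have e1 : 2.718 * (1 + w + w ^ 2 / 2 + w ^ 3 / 6 - 5 / 96 * w ^ 4) ≤ exp (1 + w) := by
    rw [exp_add]
    have hp : 0 ≤ 1 + w + w ^ 2 / 2 + w ^ 3 / 6 - 5 / 96 * w ^ 4 := by
      have : -0.34 ≤ w := by nlinarith
      have : w ≤ 0.1 := by nlinarith
      nlinarith [sq_nonneg w, sq_nonneg (w ^ 2), mul_nonneg (sq_nonneg w) (by linarith : (0:ℝ) ≤ w + 0.34)]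
    have : (2.718 : ℝ) ≤ exp 1 := by linarith [exp_one_gt_d9]
    nlinarith
  refine le_trans ?_ (e1.trans (exp_le_exp.2 hle))
  rw [hw]
  linarith [hB 0 8, hB 1 7, hB 2 6, hB 3 5, hB 4 4, hB 5 3, hB 6 2, hB 7 1, hB 8 0]

/-- Lower bound for `(n - 1) G3` at the zero of `H3`, written with `v = n - 2` and
`l = -(n + 1) log q`. -/
lemma numerical_bound_pos {v l : ℝ} (h0 : 0 ≤ v) (h1 : v ≤ 1) (hl : 0 < l)
    (h : exp l - 1 - l = (v + 3) ^ 2 / (v + 2)) :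
    0 < (exp (l * ((v + 1) / (v + 3))) - 1) * (3 * v + 4) / (2 * (v + 1)) - (v + 1) / 2
      - (v + 2) * l / (2 * (v + 3))
      + (v + 1) * ((v + 2) / 1.55) * (1 - l - (v + 2) * l ^ 2 / (2 * (v + 3) ^ 2)) / (v + 3) := by
  set a := 2.015 + 0.115 * v with ha
  obtain ⟨e, he, rfl⟩ : ∃ e, 0 ≤ e ∧ l = a + e :=
    ⟨l - a, sub_nonneg.2 (affine_le_of_exp_eq h0 h1 hl h), by ring⟩
  have hup : a + e ≤ 2.5 := by
    have hs := Real.sum_le_exp_of_nonneg hl.le 4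
    simp only [Finset.sum_range_succ, Finset.sum_range_zero, Nat.factorial] at hs
    norm_num at hs
    have : (v + 3) ^ 2 / (v + 2) ≤ 5.34 := by
      rw [div_le_iff₀ (by linarith)]; nlinarith
    by_contra! hgt
    have : (2.5:ℝ) ^ 2 ≤ (a + e) ^ 2 := by gcongr
    have : (2.5:ℝ) ^ 3 ≤ (a + e) ^ 3 := by gcongr
    linarith
  have hy0 := affine_le_exp_mul h0 h1
  rw [← ha] at hy0
  have ht : 0 ≤ (v + 1) / (v + 3) := by positivity
  have hy : (1.94 + 0.9555 * v) * (1 + e * ((v + 1) / (v + 3))) ≤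
      exp ((a + e) * ((v + 1) / (v + 3))) := by
    rw [add_mul a e, exp_add]
    have h2 := add_one_le_exp (e * ((v + 1) / (v + 3)))
    have h3 : 0 ≤ e * ((v + 1) / (v + 3)) := by positivity
    gcongr
    linarith
  have hB : ∀ i j : ℕ, 0 ≤ v ^ i * (1 - v) ^ j := fun i j =>
    mul_nonneg (pow_nonneg h0 i) (pow_nonneg (sub_nonneg.2 h1) j)
  have base : 0 < (1.94 + 0.9555 * v - 1) * (3 * v + 4) / (2 * (v + 1)) - (v + 1) / 2
      - (v + 2) * a / (2 * (v + 3))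
      + (v + 1) * ((v + 2) / 1.55) * (1 - a - (v + 2) * a ^ 2 / (2 * (v + 3) ^ 2)) / (v + 3) := by
    have key : (1.94 + 0.9555 * v - 1) * (3 * v + 4) / (2 * (v + 1)) - (v + 1) / 2
        - (v + 2) * a / (2 * (v + 3))
        + (v + 1) * ((v + 2) / 1.55) * (1 - a - (v + 2) * a ^ 2 / (2 * (v + 3) ^ 2)) / (v + 3) =
        ((1.94 + 0.9555 * v - 1) * (3 * v + 4) * (v + 3) ^ 3 - (v + 1) ^ 2 * (v + 3) ^ 3
          - (v + 2) * a * (v + 1) * (v + 3) ^ 2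
          + 40 / 31 * (v + 1) ^ 2 * (v + 2) * ((1 - a) * (v + 3) ^ 2 - (v + 2) * a ^ 2 / 2))
          / (2 * (v + 1) * (v + 3) ^ 3) := by
      field_simp
      ring
    rw [key]
    refine div_pos ?_ (by positivity)
    rw [ha]
    linarith [hB 0 6, hB 1 5, hB 2 4, hB 3 3, hB 4 2, hB 5 1, hB 6 0]
  have slope : 0 ≤ (1.94 + 0.9555 * v) * (3 * v + 4) - (v + 2)
      - 2 * (v + 1) * ((v + 2) / 1.55) * (1 + (v + 2) * (2 * a + e) / (2 * (v + 3) ^ 2)) := by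
    have h1' : (v + 2) * (2 * a + e) / (2 * (v + 3) ^ 2) ≤ 0.6 := by
      rw [div_le_iff₀ (by positivity)]
      nlinarith
    generalize (v + 2) * (2 * a + e) / (2 * (v + 3) ^ 2) = r at h1' ⊢
    have h2' : 2 * (v + 1) * ((v + 2) / 1.55) * (1 + r) ≤
        2 * (v + 1) * ((v + 2) / 1.55) * (1 + 0.6) := by gcongr
    ring_nf at h2' ⊢
    nlinarith [sq_nonneg v]
  have hdiff : 0 ≤ e * ((1.94 + 0.9555 * v) * (3 * v + 4) - (v + 2)
      - 2 * (v + 1) * ((v + 2) / 1.55) * (1 + (v + 2) * (2 * a + e) / (2 * (v + 3) ^ 2)))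
      / (2 * (v + 3)) := by positivity
  have hY : ((1.94 + 0.9555 * v) * (1 + e * ((v + 1) / (v + 3))) - 1) * (3 * v + 4) / (2 * (v + 1))
      ≤ (exp ((a + e) * ((v + 1) / (v + 3))) - 1) * (3 * v + 4) / (2 * (v + 1)) := by gcongr
  have hsum : (1.94 + 0.9555 * v - 1) * (3 * v + 4) / (2 * (v + 1)) - (v + 1) / 2
      - (v + 2) * a / (2 * (v + 3))
      + (v + 1) * ((v + 2) / 1.55) * (1 - a - (v + 2) * a ^ 2 / (2 * (v + 3) ^ 2)) / (v + 3)
      + e * ((1.94 + 0.9555 * v) * (3 * v + 4) - (v + 2)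
      - 2 * (v + 1) * ((v + 2) / 1.55) * (1 + (v + 2) * (2 * a + e) / (2 * (v + 3) ^ 2)))
      / (2 * (v + 3)) =
      ((1.94 + 0.9555 * v) * (1 + e * ((v + 1) / (v + 3))) - 1) * (3 * v + 4) / (2 * (v + 1))
      - (v + 1) / 2 - (v + 2) * (a + e) / (2 * (v + 3))
      + (v + 1) * ((v + 2) / 1.55) *
        (1 - (a + e) - (v + 2) * (a + e) ^ 2 / (2 * (v + 3) ^ 2)) / (v + 3) := by
    clear_value a
    field_simp
    ring
  linarith

/-- Minus the `μ`-independent part of `F1`. -/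
def G1 (n k q : ℝ) : ℝ := (q / q ^ n - 1) / (n - 1) + k * Real.log q

/-- Minus the `μ`-independent part of `F2`. -/
def G2 (n k q : ℝ) : ℝ :=
  (q ^ 2 - 1) / (2 * (n - 1)) - (q ^ n * q - 1) / ((n - 1) * (n + 1))
    + k * (q ^ n * q * Real.log q / (n + 1) - (q ^ n * q - 1) / (n + 1) ^ 2)

/-- The coefficient of `μ d` in `F2`. -/
def H2 (n q : ℝ) : ℝ := (q ^ n * q - 1) / (n + 1)

/-- The coefficient of `μ d` in `F3`. -/
def H3 (n q : ℝ) : ℝ :=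
  1 - n * ((Real.log q + (1 / (q ^ n * q) - 1) / (n + 1)) / (n + 1))

/-- Minus the `μ`-independent part of `F3`. -/
def G3 (n k q : ℝ) : ℝ :=
  G1 n k q - n * ((-(q / q ^ n - 1) / (n - 1) + (1 / (q ^ n * q) - 1) / (n + 1)) / (2 * (n - 1))
    - (Real.log q + (1 / (q ^ n * q) - 1) / (n + 1)) / ((n - 1) * (n + 1))
    + k * (Real.log q ^ 2 / (2 * (n + 1))
      - (Real.log q + (1 / (q ^ n * q) - 1) / (n + 1)) / (n + 1) ^ 2))

/-- `(μ₂ - μ₁)` multiplied by the positive weight `-H2` (for `d = 1`). -/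
def gap (n k q : ℝ) : ℝ := G1 n k q * H2 n q - G2 n k q

/-- The ratio of the derivatives of `G3` and `H3`. -/
def slopeRatio (n k q : ℝ) : ℝ := ((q ^ 2 - k * (q ^ n * q)) / n + G2 n k q) / H2 n q

/-- The derivative of `μ₃` up to a positive factor. -/
def wronsk (n k q : ℝ) : ℝ := slopeRatio n k q * H3 n q - G3 n k q

/-- The derivative of `slopeRatio` up to a positive factor. -/
def turn (n k q : ℝ) : ℝ :=
  (k * (n + 1) - 2 * (q / q ^ n) - (n - 1) * q ^ 2) / n + (n + 1) * gap n k q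

section Derivatives

variable {n k q : ℝ}

lemma hasDerivAt_rpow_mul_div (hq : 0 < q) : HasDerivAt (fun x : ℝ => x ^ n) (n * q ^ n / q) q := by
  have h := Real.hasDerivAt_rpow_const (x := q) (p := n) (Or.inl hq.ne')
  rwa [Real.rpow_sub_one hq.ne', ← mul_div_assoc] at h

lemma hasDerivAt_G1 (hn : 2 ≤ n) (hq : 0 < q) :
    HasDerivAt (G1 n k) (k / q - 1 / q ^ n) q := by
  have hP : 0 < q ^ n := Real.rpow_pos_of_pos hq n
  have h1 : n - 1 ≠ 0 := by linarith
  have hp := hasDerivAt_rpow_mul_div (n := n) hq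
  have hl := Real.hasDerivAt_log hq.ne'
  have h := ((((hasDerivAt_id' q).div hp hP.ne').sub_const 1).div_const (n - 1)).add
    (hl.const_mul k)
  refine h.congr_deriv ?_
  field_simp
  ring

lemma hasDerivAt_H2 (hn : 2 ≤ n) (hq : 0 < q) : HasDerivAt (H2 n) (q ^ n) q := by
  have h1 : n + 1 ≠ 0 := by linarith
  have hp := hasDerivAt_rpow_mul_div (n := n) hq
  have h := ((hp.mul (hasDerivAt_id' q)).sub_const 1).div_const (n + 1)
  refine h.congr_deriv ?_
  field_simp

lemma hasDerivAt_G2 (hn : 2 ≤ n) (hq : 0 < q) :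
    HasDerivAt (G2 n k) (G1 n k q * q ^ n) q := by
  have hP : 0 < q ^ n := Real.rpow_pos_of_pos hq n
  have h1 : n - 1 ≠ 0 := by linarith
  have h2 : n + 1 ≠ 0 := by linarith
  have hp := hasDerivAt_rpow_mul_div (n := n) hq
  have hl := Real.hasDerivAt_log hq.ne'
  have hpq := hp.mul (hasDerivAt_id' q)
  have h := ((((hasDerivAt_pow 2 q).sub_const 1).div_const (2 * (n - 1))).sub
    ((hpq.sub_const 1).div_const ((n - 1) * (n + 1)))).add
    ((((hpq.mul hl).div_const (n + 1)).sub ((hpq.sub_const 1).div_const ((n + 1) ^ 2))).const_mul k)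
  refine h.congr_deriv ?_
  simp only [G1, Pi.mul_apply]
  field_simp
  ring

lemma hasDerivAt_one_div_rpow_mul (hq : 0 < q) :
    HasDerivAt (fun x : ℝ => 1 / (x ^ n * x)) (-(n + 1) / (q ^ n * q ^ 2)) q := by
  have hP : 0 < q ^ n := Real.rpow_pos_of_pos hq n
  have hp := hasDerivAt_rpow_mul_div (n := n) hq
  have h := (hasDerivAt_const q (1 : ℝ)).div (hp.mul (hasDerivAt_id' q))
    (mul_pos hP hq).ne'
  refine h.congr_deriv ?_
  simp only [Pi.mul_apply]
  field_simp
  ring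

lemma hasDerivAt_H3 (hn : 2 ≤ n) (hq : 0 < q) :
    HasDerivAt (H3 n) (-n * H2 n q / (q ^ n * q ^ 2)) q := by
  have hP : 0 < q ^ n := Real.rpow_pos_of_pos hq n
  have h2 : n + 1 ≠ 0 := by linarith
  have hl := Real.hasDerivAt_log hq.ne'
  have hx := hasDerivAt_one_div_rpow_mul (n := n) hq
  have h := (((hl.add ((hx.sub_const 1).div_const (n + 1))).div_const (n + 1)).const_mul n).const_sub 1
  refine h.congr_deriv ?_
  simp only [H2]
  field_simp
  ring

lemma hasDerivAt_G3 (hn : 2 ≤ n) (hq : 0 < q) :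
    HasDerivAt (G3 n k) (k / q - 1 / q ^ n - n * (G2 n k q / (q ^ n * q ^ 2))) q := by
  have hP : 0 < q ^ n := Real.rpow_pos_of_pos hq n
  have h1 : n - 1 ≠ 0 := by linarith
  have h2 : n + 1 ≠ 0 := by linarith
  have hp := hasDerivAt_rpow_mul_div (n := n) hq
  have hl := Real.hasDerivAt_log hq.ne'
  have hx := hasDerivAt_one_div_rpow_mul (n := n) hq
  have hy := ((hasDerivAt_id' q).div hp hP.ne').sub_const 1
  have hlx := hl.add ((hx.sub_const 1).div_const (n + 1))
  have h := (hasDerivAt_G1 (k := k) hn hq).sub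
    (((((hy.neg.div_const (n - 1)).add ((hx.sub_const 1).div_const (n + 1))).div_const
      (2 * (n - 1))).sub (hlx.div_const ((n - 1) * (n + 1)))).add
      ((((hl.pow 2).div_const (2 * (n + 1))).sub (hlx.div_const ((n + 1) ^ 2))).const_mul k)
      |>.const_mul n)
  refine h.congr_deriv ?_
  simp only [G2]
  field_simp
  ring

lemma hasDerivAt_gap (hn : 2 ≤ n) (hq : 0 < q) :
    HasDerivAt (gap n k) ((k / q - 1 / q ^ n) * H2 n q) q := by
  have h := ((hasDerivAt_G1 (k := k) hn hq).mul (hasDerivAt_H2 hn hq)).sub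
    (hasDerivAt_G2 (k := k) hn hq)
  refine h.congr_deriv ?_
  ring

lemma hasDerivAt_turn (hn : 2 ≤ n) (hq : 0 < q) :
    HasDerivAt (turn n k) (2 * (n - 1) / n * (1 / q ^ n - q)
      + (n + 1) * ((k / q - 1 / q ^ n) * H2 n q)) q := by
  have hP : 0 < q ^ n := Real.rpow_pos_of_pos hq n
  have hp := hasDerivAt_rpow_mul_div (n := n) hq
  have hy := (hasDerivAt_id' q).div hp hP.ne'
  have h := ((((hy.const_mul 2).const_sub (k * (n + 1))).sub
    ((hasDerivAt_pow 2 q).const_mul (n - 1))).div_const n).add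
    ((hasDerivAt_gap (k := k) hn hq).const_mul (n + 1))
  refine h.congr_deriv ?_
  have : n ≠ 0 := by linarith
  field_simp
  ring

lemma rpow_mul_self_lt_one (hn : 2 ≤ n) (hq : 0 < q) (hq1 : q < 1) : q ^ n * q < 1 := by
  have h1 : q ^ n < 1 := Real.rpow_lt_one hq.le hq1 (by linarith)
  nlinarith

lemma H2_neg (hn : 2 ≤ n) (hq : 0 < q) (hq1 : q < 1) : H2 n q < 0 :=
  div_neg_of_neg_of_pos (by linarith [rpow_mul_self_lt_one hn hq hq1]) (by linarith)

lemma hasDerivAt_G2_div_H2 (hn : 2 ≤ n) (hq : 0 < q) (hq1 : q < 1) :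
    HasDerivAt (fun x => G2 n k x / H2 n x) (q ^ n * gap n k q / H2 n q ^ 2) q := by
  have h := (hasDerivAt_G2 (k := k) hn hq).div (hasDerivAt_H2 hn hq) (H2_neg hn hq hq1).ne
  refine h.congr_deriv ?_
  simp only [gap]
  ring

lemma hasDerivAt_slopeRatio (hn : 2 ≤ n) (hq : 0 < q) (hq1 : q < 1) :
    HasDerivAt (slopeRatio n k) (q ^ n * turn n k q / ((n + 1) * H2 n q ^ 2)) q := by
  have hP : 0 < q ^ n := Real.rpow_pos_of_pos hq n
  have hp := hasDerivAt_rpow_mul_div (n := n) hq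
  have h0 := (H2_neg hn hq hq1).ne
  have h := ((((hasDerivAt_pow 2 q).sub ((hp.mul (hasDerivAt_id' q)).const_mul k)).div_const n).add
    (hasDerivAt_G2 (k := k) hn hq)).div (hasDerivAt_H2 hn hq) h0
  refine h.congr_deriv ?_
  have hn0 : n ≠ 0 := by linarith
  have h2 : n + 1 ≠ 0 := by linarith
  have hH : q ^ n * q - 1 ≠ 0 := by linarith [rpow_mul_self_lt_one hn hq hq1]
  simp only [turn, gap, H2, Pi.mul_apply, Pi.add_apply, Pi.sub_apply]
  field_simp
  ring

lemma hasDerivAt_wronsk (hn : 2 ≤ n) (hq : 0 < q) (hq1 : q < 1) :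
    HasDerivAt (wronsk n k) (q ^ n * turn n k q / ((n + 1) * H2 n q ^ 2) * H3 n q) q := by
  have hP : 0 < q ^ n := Real.rpow_pos_of_pos hq n
  have h0 := (H2_neg hn hq hq1).ne
  have h := ((hasDerivAt_slopeRatio (k := k) hn hq hq1).mul (hasDerivAt_H3 hn hq)).sub
    (hasDerivAt_G3 (k := k) hn hq)
  refine h.congr_deriv ?_
  have hn0 : n ≠ 0 := by linarith
  have : slopeRatio n k q * (-n * H2 n q / (q ^ n * q ^ 2)) =
      k / q - 1 / q ^ n - n * (G2 n k q / (q ^ n * q ^ 2)) := by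
    simp only [slopeRatio]
    field_simp
    ring
  rw [this]
  ring

lemma hasDerivAt_G3_div_H3 (hn : 2 ≤ n) (hq : 0 < q) (hq1 : q < 1) (h3 : H3 n q ≠ 0) :
    HasDerivAt (fun x => G3 n k x / H3 n x)
      (-n * H2 n q / (q ^ n * q ^ 2) * wronsk n k q / H3 n q ^ 2) q := by
  have hP : 0 < q ^ n := Real.rpow_pos_of_pos hq n
  have h0 := (H2_neg hn hq hq1).ne
  have h := (hasDerivAt_G3 (k := k) hn hq).div (hasDerivAt_H3 hn hq) h3
  refine h.congr_deriv ?_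
  have hn0 : n ≠ 0 := by linarith
  simp only [wronsk, slopeRatio]
  field_simp
  ring

end Derivatives

lemma strictMonoOn_of_hasDerivAt_pos {f f' : ℝ → ℝ} {s : Set ℝ} (hs : Convex ℝ s)
    (hd : ∀ x ∈ s, HasDerivAt f (f' x) x) (hp : ∀ x ∈ interior s, 0 < f' x) :
    StrictMonoOn f s :=
  strictMonoOn_of_deriv_pos hs (fun x hx => (hd x hx).continuousAt.continuousWithinAt)
    fun x hx => by rw [(hd x (interior_subset hx)).deriv]; exact hp x hx

lemma strictAntiOn_of_hasDerivAt_neg {f f' : ℝ → ℝ} {s : Set ℝ} (hs : Convex ℝ s)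
    (hd : ∀ x ∈ s, HasDerivAt f (f' x) x) (hp : ∀ x ∈ interior s, f' x < 0) :
    StrictAntiOn f s :=
  strictAntiOn_of_deriv_neg hs (fun x hx => (hd x hx).continuousAt.continuousWithinAt)
    fun x hx => by rw [(hd x (interior_subset hx)).deriv]; exact hp x hx

/-- If the derivative changes sign from negative to positive at `c`, then `c` is the unique
minimum. -/
lemma unique_min_of_hasDerivAt {f f' : ℝ → ℝ} {a b c : ℝ} (hc : c ∈ Ioo a b)
    (hd : ∀ x ∈ Ioo a b, HasDerivAt f (f' x) x) (hneg : ∀ x ∈ Ioo a c, f' x < 0)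
    (hpos : ∀ x ∈ Ioo c b, 0 < f' x) {x : ℝ} (hx : x ∈ Ioo a b) (hne : x ≠ c) : f c < f x := by
  rcases lt_or_gt_of_ne hne with h | h
  · exact strictAntiOn_of_hasDerivAt_neg (convex_Ioc a c)
      (fun y hy => hd y ⟨hy.1, hy.2.trans_lt hc.2⟩)
      (fun y hy => hneg y (by rwa [interior_Ioc] at hy)) ⟨hx.1, h.le⟩ ⟨hc.1, le_rfl⟩ h
  · exact strictMonoOn_of_hasDerivAt_pos (convex_Ico c b)
      (fun y hy => hd y ⟨hc.1.trans_le hy.1, hy.2⟩)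
      (fun y hy => hpos y (by rwa [interior_Ico] at hy)) ⟨le_rfl, hc.2⟩ ⟨h.le, hx.2⟩ h

section Values

variable {n k : ℝ}

lemma G1_one : G1 n k 1 = 0 := by simp [G1]

lemma G2_one : G2 n k 1 = 0 := by simp [G2]

lemma H2_one : H2 n 1 = 0 := by simp [H2]

lemma G3_one : G3 n k 1 = 0 := by simp [G3, G1_one]

lemma H3_one : H3 n 1 = 1 := by simp [H3]

lemma gap_one : gap n k 1 = 0 := by simp [gap, G2_one, H2_one]

end Values

section Signs

variable {n k q₁ : ℝ}

lemma H3_strictMonoOn (hn : 2 ≤ n) : StrictMonoOn (H3 n) (Ioc 0 1) := by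
  refine strictMonoOn_of_hasDerivAt_pos (convex_Ioc _ _) (fun q hq => hasDerivAt_H3 hn hq.1) ?_
  intro q hq
  rw [interior_Ioc] at hq
  have := H2_neg hn hq.1 hq.2
  have := Real.rpow_pos_of_pos hq.1 n
  have := hq.1
  exact div_pos (by nlinarith) (by positivity)

lemma G1_deriv_neg {q : ℝ} (hq : 0 < q) (h : k * q ^ n < q) : k / q - 1 / q ^ n < 0 := by
  have := Real.rpow_pos_of_pos hq n
  rw [sub_neg, div_lt_div_iff₀ hq this]
  linarith

lemma G1_deriv_pos {q : ℝ} (hq : 0 < q) (h : q < k * q ^ n) : 0 < k / q - 1 / q ^ n := by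
  have := Real.rpow_pos_of_pos hq n
  rw [sub_pos, div_lt_div_iff₀ this hq]
  linarith

lemma gap_strictMonoOn (hn : 2 ≤ n) (hq₁ : q₁ < 1)
    (hlt : ∀ q ∈ Ioo 0 q₁, k * q ^ n < q) : StrictMonoOn (gap n k) (Ioc 0 q₁) := by
  refine strictMonoOn_of_hasDerivAt_pos (convex_Ioc _ _) (fun q hq => hasDerivAt_gap hn hq.1) ?_
  intro q hq
  rw [interior_Ioc] at hq
  exact mul_pos_of_neg_of_neg (G1_deriv_neg hq.1 (hlt q hq)) (H2_neg hn hq.1 (hq.2.trans hq₁))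

lemma gap_pos (hn : 2 ≤ n) (h0 : 0 < q₁) (hgt : ∀ q ∈ Ioo q₁ 1, q < k * q ^ n) {q : ℝ}
    (hq : q ∈ Ico q₁ 1) : 0 < gap n k q := by
  have h := strictAntiOn_of_hasDerivAt_neg (convex_Icc q₁ 1)
    (fun q hq => hasDerivAt_gap (k := k) hn (h0.trans_le hq.1)) (fun q hq => by
      rw [interior_Icc] at hq
      exact mul_neg_of_pos_of_neg (G1_deriv_pos (h0.trans hq.1) (hgt q hq))
        (H2_neg hn (h0.trans hq.1) hq.2))
  rw [← gap_one (n := n) (k := k)]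
  exact h ⟨hq.1, hq.2.le⟩ ⟨hq.1.trans hq.2.le, le_rfl⟩ hq.2

lemma G1_lt_G2_div_H2 (hn : 2 ≤ n) {q : ℝ} (hq : 0 < q) (hq1 : q < 1) (h : 0 < gap n k q) :
    G1 n k q < G2 n k q / H2 n q := by
  rw [lt_div_iff_of_neg (H2_neg hn hq hq1)]
  simpa [gap] using h

/-- `μ₃` is controlled by `μ₁` and `μ₂` wherever `μ₂ > μ₁` to the right. -/
lemma G3_lt (hn : 2 ≤ n) {q₀ : ℝ} (h0 : 0 < q₀) (h1 : q₀ < 1)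
    (hgap : ∀ q ∈ Ioo q₀ 1, 0 < gap n k q) :
    G3 n k q₀ < G1 n k q₀ + G2 n k q₀ / H2 n q₀ * (H3 n q₀ - 1) := by
  set a := G2 n k q₀ / H2 n q₀ with ha
  have hm : StrictMonoOn (fun x => G2 n k x / H2 n x) (Ico q₀ 1) := by
    refine strictMonoOn_of_hasDerivAt_pos (convex_Ico _ _)
      (fun q hq => hasDerivAt_G2_div_H2 hn (h0.trans_le hq.1) hq.2) ?_
    intro q hq
    rw [interior_Ico] at hq
    have h2 := H2_neg hn (h0.trans hq.1) hq.2
    have hP := Real.rpow_pos_of_pos (h0.trans hq.1) n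
    exact div_pos (mul_pos hP (hgap q hq)) (sq_pos_of_neg h2)
  have hJ : StrictMonoOn (fun x => G3 n k x - G1 n k x - a * (H3 n x - 1)) (Icc q₀ 1) := by
    refine strictMonoOn_of_hasDerivAt_pos (convex_Icc _ _)
      (fun q hq => ((hasDerivAt_G3 hn (h0.trans_le hq.1)).sub
        (hasDerivAt_G1 hn (h0.trans_le hq.1))).sub
        (((hasDerivAt_H3 hn (h0.trans_le hq.1)).sub_const 1).const_mul a)) ?_
    intro q hq
    rw [interior_Icc] at hq
    have hq0 := h0.trans hq.1
    have h2 := H2_neg hn hq0 hq.2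
    have hP := Real.rpow_pos_of_pos hq0 n
    have h3 : a < G2 n k q / H2 n q := hm ⟨le_rfl, h1⟩ ⟨hq.1.le, hq.2⟩ hq.1
    rw [lt_div_iff_of_neg h2] at h3
    have h4 : 0 < n * ((a * H2 n q - G2 n k q) / (q ^ n * q ^ 2)) :=
      mul_pos (by linarith) (div_pos (by linarith) (by positivity))
    refine h4.trans_eq ?_
    field_simp
    ring
  have h := hJ ⟨le_rfl, h1.le⟩ ⟨h1.le, le_rfl⟩ h1
  simp only [G3_one, G1_one, H3_one] at h
  linarith

lemma H3_lt_one (hn : 2 ≤ n) {q : ℝ} (hq : 0 < q) (hq1 : q < 1) : H3 n q < 1 :=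
  (H3_strictMonoOn hn ⟨hq, hq1.le⟩ ⟨one_pos, le_rfl⟩ hq1).trans_eq H3_one

/-- Positivity of `G3` at the zero of `H3` forces the gap to be negative there. -/
lemma gap_neg_of_G3_pos (hn : 2 ≤ n) (h0 : 0 < q₁) (h1 : q₁ < 1)
    (hlt : ∀ q ∈ Ioo 0 q₁, k * q ^ n < q) (hgt : ∀ q ∈ Ioo q₁ 1, q < k * q ^ n)
    {q : ℝ} (hq : 0 < q) (hq1 : q < 1) (hH : H3 n q = 0) (hG : 0 < G3 n k q) :
    gap n k q < 0 := by
  by_contra! hge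
  have hpos : ∀ x ∈ Ioo q 1, 0 < gap n k x := by
    intro x hx
    rcases lt_or_ge x q₁ with hx1 | hx1
    · exact hge.trans_lt (gap_strictMonoOn hn h1 hlt ⟨hq, (hx.1.trans hx1).le⟩
        ⟨hq.trans hx.1, hx1.le⟩ hx.1)
    · exact gap_pos hn h0 hgt ⟨hx1, hx.2⟩
  have h := G3_lt hn hq hq1 hpos
  have h2 : G1 n k q ≤ G2 n k q / H2 n q := by
    rw [le_div_iff_of_neg (H2_neg hn hq hq1)]
    simpa [gap] using hge
  rw [hH] at h
  linarith

lemma turn_strictMonoOn (hn : 2 ≤ n) (h1 : q₁ < 1)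
    (hlt : ∀ q ∈ Ioo 0 q₁, k * q ^ n < q) : StrictMonoOn (turn n k) (Ioc 0 q₁) := by
  refine strictMonoOn_of_hasDerivAt_pos (convex_Ioc _ _) (fun q hq => hasDerivAt_turn hn hq.1) ?_
  intro q hq
  rw [interior_Ioc] at hq
  have hq1 := hq.2.trans h1
  have hP := Real.rpow_pos_of_pos hq.1 n
  have h2 := mul_pos_of_neg_of_neg (G1_deriv_neg hq.1 (hlt q hq)) (H2_neg hn hq.1 hq1)
  have h3 : 0 < 1 / q ^ n - q := by
    rw [sub_pos, lt_div_iff₀ hP, mul_comm]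
    exact rpow_mul_self_lt_one hn hq.1 hq1
  have h4 : 0 < 2 * (n - 1) / n := div_pos (by linarith) (by linarith)
  have h5 : 0 < n + 1 := by linarith
  positivity

lemma turn_pos (hn : 2 ≤ n) (hk : 1 < k) {q : ℝ} (hq : 0 < q) (hq1 : q < 1) (hle : q ≤ k * q ^ n)
    (hgap : 0 < gap n k q) : 0 < turn n k q := by
  have hP := Real.rpow_pos_of_pos hq n
  have h1 : q / q ^ n ≤ k := by rwa [div_le_iff₀ hP]
  have h2 : 0 < (n - 1) * (k - q ^ 2) := mul_pos (by linarith) (by nlinarith)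
  exact add_pos (div_pos (by linarith) (by linarith)) (mul_pos (by linarith) hgap)

/-- The sign change of the derivative of `μ₃`. -/
lemma exists_wronsk_sign_change (hn : 2 ≤ n) (hk : 1 < k) (h1 : q₁ < 1)
    (hlt : ∀ q ∈ Ioo 0 q₁, k * q ^ n < q) (heq : k * q₁ ^ n = q₁)
    (hgt : ∀ q ∈ Ioo q₁ 1, q < k * q ^ n) {qs : ℝ} (hs : 0 < qs) (hs1 : qs < q₁)
    (hH : H3 n qs = 0) (hG : 0 < G3 n k qs) :
    ∃ q₃ ∈ Ioo qs 1, (∀ q ∈ Ioo qs q₃, wronsk n k q < 0) ∧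
      ∀ q ∈ Ioo q₃ 1, 0 < wronsk n k q := by
  have h0 : 0 < q₁ := hs.trans hs1
  have hgp : ∀ q ∈ Ico q₁ 1, 0 < gap n k q := fun q hq => gap_pos hn h0 hgt hq
  have hH3 : ∀ q ∈ Ioo qs 1, 0 < H3 n q := fun q hq => by
    rw [← hH]
    exact H3_strictMonoOn hn ⟨hs, (hs1.trans h1).le⟩ ⟨hs.trans hq.1, hq.2.le⟩ hq.1
  have hTpos : ∀ q ∈ Ico q₁ 1, 0 < turn n k q := by
    intro q hq
    refine turn_pos hn hk (h0.trans_le hq.1) hq.2 ?_ (hgp q hq)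
    rcases hq.1.eq_or_lt with rfl | h
    · exact heq.ge
    · exact (hgt q ⟨h, hq.2⟩).le
  have hTmono := turn_strictMonoOn hn h1 hlt
  obtain ⟨z, hz, hzneg, hzpos⟩ : ∃ z ∈ Ico qs q₁, (∀ q ∈ Ioo qs z, turn n k q < 0) ∧
      ∀ q ∈ Ioo z 1, 0 < turn n k q := by
    have hright : ∀ z ∈ Ico qs q₁, 0 ≤ turn n k z → ∀ q ∈ Ioo z 1, 0 < turn n k q := by
      intro z hz hTz q hq
      rcases lt_or_ge q q₁ with hqq | hqq
      · exact hTz.trans_lt (hTmono ⟨hs.trans_le hz.1, hz.2.le⟩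
          ⟨(hs.trans_le hz.1).trans hq.1, hqq.le⟩ hq.1)
      · exact hTpos q ⟨hqq, hq.2⟩
    rcases le_or_gt 0 (turn n k qs) with hT | hT
    · exact ⟨qs, ⟨le_rfl, hs1⟩, by simp, hright qs ⟨le_rfl, hs1⟩ hT⟩
    · have hcont : ContinuousOn (turn n k) (Icc qs q₁) := fun q hq =>
        (hasDerivAt_turn hn (hs.trans_le hq.1)).continuousAt.continuousWithinAt
      obtain ⟨z, hz, hz0⟩ := intermediate_value_Ioo hs1.le hcont ⟨hT, hTpos q₁ ⟨le_rfl, h1⟩⟩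
      refine ⟨z, ⟨hz.1.le, hz.2⟩, fun q hq => ?_, hright z ⟨hz.1.le, hz.2⟩ hz0.ge⟩
      rw [← hz0]
      exact hTmono ⟨hs.trans hq.1, (hq.2.trans hz.2).le⟩ ⟨hs.trans hz.1, hz.2.le⟩ hq.2
  have hz0 : 0 < z := hs.trans_le hz.1
  have hz1 : z < 1 := hz.2.trans h1
  have hfac : ∀ q ∈ Ioo qs 1, 0 < q ^ n / ((n + 1) * H2 n q ^ 2) * H3 n q := by
    intro q hq
    have hq0 := hs.trans hq.1
    have hP := Real.rpow_pos_of_pos hq0 n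
    have h2 := H2_neg hn hq0 hq.2
    have h3 := hH3 q hq
    have h5 : 0 < n + 1 := by linarith
    have h6 : 0 < H2 n q ^ 2 := sq_pos_of_neg h2
    positivity
  have hder : ∀ q ∈ Ico qs 1, HasDerivAt (wronsk n k)
      (turn n k q * (q ^ n / ((n + 1) * H2 n q ^ 2) * H3 n q)) q := fun q hq =>
    (hasDerivAt_wronsk hn (hs.trans_le hq.1) hq.2).congr_deriv (by ring)
  have hanti : StrictAntiOn (wronsk n k) (Icc qs z) :=
    strictAntiOn_of_hasDerivAt_neg (convex_Icc _ _)
      (fun q hq => hder q ⟨hq.1, hq.2.trans_lt hz1⟩) fun q hq => by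
        rw [interior_Icc] at hq
        exact mul_neg_of_neg_of_pos (hzneg q hq) (hfac q ⟨hq.1, hq.2.trans hz1⟩)
  have hmono : StrictMonoOn (wronsk n k) (Ico z 1) :=
    strictMonoOn_of_hasDerivAt_pos (convex_Ico _ _)
      (fun q hq => hder q ⟨hz.1.trans hq.1, hq.2⟩) fun q hq => by
        rw [interior_Ico] at hq
        exact mul_pos (hzpos q hq) (hfac q ⟨hz.1.trans_lt hq.1, hq.2⟩)
  have hVs : wronsk n k qs < 0 := by simpa [wronsk, hH] using hG
  have hleft : ∀ q ∈ Icc qs z, wronsk n k q < 0 := fun q hq =>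
    (hanti.antitoneOn ⟨le_rfl, hz.1⟩ hq hq.1).trans_lt hVs
  have hV1 : 0 < wronsk n k q₁ := by
    have hg := G3_lt hn h0 h1 fun q hq => hgp q ⟨hq.1.le, hq.2⟩
    have hlt12 := G1_lt_G2_div_H2 hn h0 h1 (hgp q₁ ⟨le_rfl, h1⟩)
    have : slopeRatio n k q₁ = G2 n k q₁ / H2 n q₁ := by
      have : q₁ ^ 2 - k * (q₁ ^ n * q₁) = 0 := by linear_combination -q₁ * heq
      simp [slopeRatio, this]
    rw [wronsk, this]
    linarith
  obtain ⟨q₃, hq₃, hV3⟩ := intermediate_value_Ioo hz.2.le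
    (fun q hq => (hder q ⟨hz.1.trans hq.1, hq.2.trans_lt h1⟩).continuousAt.continuousWithinAt)
    ⟨hleft z ⟨hz.1, le_rfl⟩, hV1⟩
  have hq₃1 := hq₃.2.trans h1
  refine ⟨q₃, ⟨hz.1.trans_lt hq₃.1, hq₃1⟩, fun q hq => ?_, fun q hq => ?_⟩
  · rcases le_or_gt q z with h | h
    · exact hleft q ⟨hq.1.le, h⟩
    · rw [← hV3]
      exact hmono ⟨h.le, hq.2.trans hq₃1⟩ ⟨hq₃.1.le, hq₃1⟩ hq.2
  · rw [← hV3]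
    exact hmono ⟨hq₃.1.le, hq₃1⟩ ⟨(hq₃.1.trans hq.1).le, hq.2⟩ hq.1

end Signs

section ClosedForms

variable {d n c : ℝ}

lemma F1_eq {Q : ℝ} (hQ : 0 < Q) (μ : ℝ) : F1 d n c Q μ = -G1 n (n / c) Q + μ * d := by
  rw [F1, G1, Real.rpow_sub hQ, Real.rpow_one]
  ring

lemma pos_of_mem_uIcc_one {q Q : ℝ} (hQ : 0 < Q) (hq : q ∈ uIcc 1 Q) : 0 < q :=
  (lt_min one_pos hQ).trans_le hq.1

lemma F2_eq (hn : 2 ≤ n) {Q : ℝ} (hQ : 0 < Q) (μ : ℝ) :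
    F2 d n c Q μ = -G2 n (n / c) Q + μ * d * H2 n Q := by
  have hder : ∀ q ∈ uIcc 1 Q, HasDerivAt (fun x => -G2 n (n / c) x + μ * d * H2 n x)
      (F1 d n c q μ * q ^ n) q := by
    intro q hq
    have hq0 := pos_of_mem_uIcc_one hQ hq
    refine ((hasDerivAt_G2 hn hq0).neg.add ((hasDerivAt_H2 hn hq0).const_mul (μ * d))).congr_deriv ?_
    rw [F1_eq hq0]
    ring
  have hcont : ContinuousOn (fun q => F1 d n c q μ * q ^ n) (uIcc 1 Q) := by
    refine ContinuousOn.congr (f := fun q => (-G1 n (n / c) q + μ * d) * q ^ n) ?_ ?_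
    · intro q hq
      have hq0 := pos_of_mem_uIcc_one hQ hq
      exact (((hasDerivAt_G1 hn hq0).neg.add_const (μ * d)).mul
        (hasDerivAt_rpow_mul_div hq0)).continuousAt.continuousWithinAt
    · intro q hq
      simp only [F1_eq (pos_of_mem_uIcc_one hQ hq)]
  rw [F2, integral_eq_sub_of_hasDerivAt hder hcont.intervalIntegrable, G2_one, H2_one]
  ring

lemma F3_eq (hn : 2 ≤ n) {Q : ℝ} (hQ : 0 < Q) (μ : ℝ) :
    F3 d n c Q μ = -G3 n (n / c) Q + μ * d * H3 n Q := by
  have hn0 : n ≠ 0 := by linarith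
  have hpow : ∀ q : ℝ, 0 < q → q ^ (-(n + 2)) = 1 / (q ^ n * q ^ 2) := by
    intro q hq
    rw [Real.rpow_neg hq.le, Real.rpow_add hq, one_div]
    norm_num
  have hder : ∀ q ∈ uIcc 1 Q, HasDerivAt
      (fun x => (G3 n (n / c) x - G1 n (n / c) x - μ * d * H3 n x) / n)
      (F2 d n c q μ * q ^ (-(n + 2))) q := by
    intro q hq
    have hq0 := pos_of_mem_uIcc_one hQ hq
    refine ((((hasDerivAt_G3 hn hq0).sub (hasDerivAt_G1 hn hq0)).sub
      ((hasDerivAt_H3 hn hq0).const_mul (μ * d))).div_const n).congr_deriv ?_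
    rw [F2_eq hn hq0, hpow q hq0]
    field_simp
    ring
  have hcont : ContinuousOn (fun q => F2 d n c q μ * q ^ (-(n + 2))) (uIcc 1 Q) := by
    refine ContinuousOn.congr
      (f := fun q => (-G2 n (n / c) q + μ * d * H2 n q) * q ^ (-(n + 2))) ?_ ?_
    · intro q hq
      have hq0 := pos_of_mem_uIcc_one hQ hq
      exact (((hasDerivAt_G2 hn hq0).neg.add ((hasDerivAt_H2 hn hq0).const_mul (μ * d))).mul
        (hasDerivAt_rpow_mul_div hq0)).continuousAt.continuousWithinAt
    · intro q hq
      simp only [F2_eq hn (pos_of_mem_uIcc_one hQ hq)]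
  rw [F3, integral_eq_sub_of_hasDerivAt hder hcont.intervalIntegrable, F1_eq hQ, G3_one, G1_one,
    H3_one]
  field_simp
  ring

lemma mu1_eq {Q : ℝ} (hQ : 0 < Q) : mu1 d n c Q = G1 n (n / c) Q / d := by
  simp only [mu1, F1_eq hQ]
  ring

lemma mu2_eq (hn : 2 ≤ n) {Q : ℝ} (hQ : 0 < Q) :
    mu2 d n c Q = G2 n (n / c) Q / H2 n Q / d := by
  simp only [mu2, F2_eq hn hQ]
  rw [div_div, mul_comm (H2 n Q) d]
  congr 1 <;> ring

lemma mu3_eq (hn : 2 ≤ n) {Q : ℝ} (hQ : 0 < Q) :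
    mu3 d n c Q = G3 n (n / c) Q / H3 n Q / d := by
  simp only [mu3, F3_eq hn hQ]
  rw [div_div, mul_comm (H3 n Q) d]
  congr 1 <;> ring

end ClosedForms

lemma G3_pos_of_H3_eq_zero {n k q : ℝ} (hn : n ∈ Icc (2:ℝ) 3) (hk : k ≤ n / 1.55)
    (hq : 0 < q) (hq1 : q < 1) (hH : H3 n q = 0) : 0 < G3 n k q := by
  obtain ⟨hn2, hn3⟩ := hn
  have hP := Real.rpow_pos_of_pos hq n
  have hn1 : 0 < n - 1 := by linarith
  have hm : 0 < n + 1 := by linarith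
  obtain ⟨l, hl⟩ : ∃ l, l = -(n + 1) * Real.log q := ⟨_, rfl⟩
  have hlog : Real.log q = -l / (n + 1) := by
    rw [hl]
    field_simp
  have hl0 : 0 < l := by
    rw [hl]
    nlinarith [Real.log_neg hq hq1]
  have hx : exp l = 1 / (q ^ n * q) := by
    rw [one_div, ← Real.rpow_add_one hq.ne', ← Real.rpow_neg hq.le, Real.rpow_def_of_pos hq, hl]
    congr 1
    ring
  have hy : exp (l * ((n - 1) / (n + 1))) = q / q ^ n := by
    have : q / q ^ n = q ^ (1 - n) := by rw [Real.rpow_sub hq, Real.rpow_one]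
    rw [this, Real.rpow_def_of_pos hq, hl]
    congr 1
    field_simp
    ring
  have hx' : 1 / (q ^ n * q) = 1 + l + (n + 1) ^ 2 / n := by
    rw [H3, hlog] at hH
    generalize 1 / (q ^ n * q) = x at hH ⊢
    field_simp at hH ⊢
    linarith
  have hv : exp l - 1 - l = (n - 2 + 3) ^ 2 / (n - 2 + 2) := by
    rw [hx, hx']
    ring
  have hpos := numerical_bound_pos (v := n - 2) (by linarith) (by linarith) hl0 hv
  have hle := affine_le_of_exp_eq (v := n - 2) (by linarith) (by linarith) hl0 hv
  rw [show n - 2 + 1 = n - 1 by ring, show n - 2 + 3 = n + 1 by ring, show n - 2 + 2 = n by ring,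
    show 3 * (n - 2) + 4 = 3 * n - 2 by ring, hy] at hpos
  have hB : 1 - l - n * l ^ 2 / (2 * (n + 1) ^ 2) ≤ 0 := by
    have : 0 ≤ n * l ^ 2 / (2 * (n + 1) ^ 2) := by positivity
    linarith
  have hkB : (n - 1) * (n / 1.55) * (1 - l - n * l ^ 2 / (2 * (n + 1) ^ 2)) / (n + 1) ≤
      (n - 1) * k * (1 - l - n * l ^ 2 / (2 * (n + 1) ^ 2)) / (n + 1) := by
    refine div_le_div_of_nonneg_right ?_ hm.le
    exact mul_le_mul_of_nonpos_right (mul_le_mul_of_nonneg_left hk hn1.le) hB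
  have key : (n - 1) * G3 n k q = (q / q ^ n - 1) * (3 * n - 2) / (2 * (n - 1)) - (n - 1) / 2
      - n * l / (2 * (n + 1))
      + (n - 1) * k * (1 - l - n * l ^ 2 / (2 * (n + 1) ^ 2)) / (n + 1) := by
    rw [G3, G1, hx', hlog]
    generalize q / q ^ n = y
    field_simp
    ring
  exact pos_of_mul_pos_right (by linarith : 0 < (n - 1) * G3 n k q) hn1.le

/-- Each μᵢ has a unique global minimum on (Q_*, 1), with the stated relations
(Lemma on μᵢ properties, item (2)). -/
theorem magma_mui_global_minima
    (d n c Qs : ℝ) (hd : 0 < d) (hn : n ∈ Icc (2:ℝ) 3) (hc : c ∈ Ico (1.55:ℝ) n)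
    (hQs : Qs ∈ Ioo (0:ℝ) 1) (hQsz : F3 d n c Qs 1 - F3 d n c Qs 0 = 0)
    (hQsu : ∀ Q ∈ Ioo (0:ℝ) 1, F3 d n c Q 1 - F3 d n c Q 0 = 0 → Q = Qs) :
    ∃ Q1 Q2 Q3 : ℝ, Q1 ∈ Ioo Qs 1 ∧ Q2 ∈ Ioo Qs 1 ∧ Q3 ∈ Ioo Qs 1 ∧
      (∀ Q ∈ Ioo Qs (1:ℝ), mu1 d n c Q1 ≤ mu1 d n c Q ∧ (mu1 d n c Q = mu1 d n c Q1 → Q = Q1)) ∧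
      (∀ Q ∈ Ioo Qs (1:ℝ), mu2 d n c Q2 ≤ mu2 d n c Q ∧ (mu2 d n c Q = mu2 d n c Q2 → Q = Q2)) ∧
      (∀ Q ∈ Ioo Qs (1:ℝ), mu3 d n c Q3 ≤ mu3 d n c Q ∧ (mu3 d n c Q = mu3 d n c Q3 → Q = Q3)) ∧
      Q1 = (c / n) ^ (1 / (n - 1)) ∧
      Q2 < Q1 ∧ mu1 d n c Q2 = mu2 d n c Q2 ∧
      mu3 d n c Q3 < mu1 d n c Q1 ∧ mu1 d n c Q1 < mu2 d n c Q2 ∧ mu2 d n c Q2 < 0 := by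
  obtain ⟨hc1, hcn⟩ := hc
  have hn2 : 2 ≤ n := hn.1
  have hc0 : 0 < c := by linarith
  have hn0 : 0 < n := by linarith
  have hn1 : 0 < n - 1 := by linarith
  obtain ⟨hs0, hs1⟩ := hQs
  have hk : 1 < n / c := by rwa [lt_div_iff₀ hc0, one_mul]
  have hk' : n / c ≤ n / 1.55 := by gcongr
  have hH : H3 n Qs = 0 := by
    rw [F3_eq hn2 hs0, F3_eq hn2 hs0] at hQsz
    have : d * H3 n Qs = 0 := by linarith
    exact (mul_eq_zero.1 this).resolve_left hd.ne'
  have hG := G3_pos_of_H3_eq_zero hn hk' hs0 hs1 hH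
  have hr0 : 0 < c / n := by positivity
  have hr1 : c / n < 1 := by rwa [div_lt_one hn0]
  obtain ⟨q₁, hq₁⟩ : ∃ q₁, q₁ = (c / n) ^ (1 / (n - 1)) := ⟨_, rfl⟩
  have h0 : 0 < q₁ := hq₁ ▸ Real.rpow_pos_of_pos hr0 _
  have h1 : q₁ < 1 := hq₁ ▸ Real.rpow_lt_one hr0.le hr1 (by positivity)
  have hpow1 : q₁ ^ (n - 1) = c / n := by
    rw [hq₁, ← Real.rpow_mul hr0.le, one_div_mul_cancel hn1.ne', Real.rpow_one]
  have hP : ∀ q : ℝ, 0 < q → n / c * q ^ n = q * (q ^ (n - 1) / (c / n)) := by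
    intro q hq
    rw [Real.rpow_sub_one hq.ne']
    field_simp
  have hlt : ∀ q ∈ Ioo 0 q₁, n / c * q ^ n < q := by
    intro q hq
    rw [hP q hq.1, ← hpow1]
    refine mul_lt_of_lt_one_right hq.1 ?_
    rw [div_lt_one (hpow1 ▸ hr0)]
    exact Real.rpow_lt_rpow hq.1.le hq.2 hn1
  have hgt : ∀ q ∈ Ioo q₁ 1, q < n / c * q ^ n := by
    intro q hq
    rw [hP q (h0.trans hq.1), ← hpow1]
    refine lt_mul_of_one_lt_right (h0.trans hq.1) ?_
    rw [one_lt_div (hpow1 ▸ hr0)]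
    exact Real.rpow_lt_rpow h0.le hq.1 hn1
  have heq : n / c * q₁ ^ n = q₁ := by
    rw [hP q₁ h0, hpow1, div_self hr0.ne', mul_one]
  have hgp : ∀ q ∈ Ico q₁ 1, 0 < gap n (n / c) q := fun q hq => gap_pos hn2 h0 hgt hq
  have hgs := gap_neg_of_G3_pos hn2 h0 h1 hlt hgt hs0 hs1 hH hG
  have hs : Qs < q₁ := by
    by_contra! h
    exact hgs.not_gt (hgp Qs ⟨h, hs1⟩)
  have hgmono := gap_strictMonoOn hn2 h1 hlt
  obtain ⟨q₂, hq₂, hgap2⟩ := intermediate_value_Ioo hs.le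
    (fun q hq => (hasDerivAt_gap (k := n / c) hn2
      (hs0.trans_le hq.1)).continuousAt.continuousWithinAt) ⟨hgs, hgp q₁ ⟨le_rfl, h1⟩⟩
  obtain ⟨q₃, hq₃, hneg3, hpos3⟩ := exists_wronsk_sign_change hn2 hk h1 hlt heq hgt hs0 hs hH hG
  have h20 : 0 < q₂ := hs0.trans hq₂.1
  have h21 : q₂ < 1 := hq₂.2.trans h1
  have hgpos : ∀ q ∈ Ioo q₂ 1, 0 < gap n (n / c) q := by
    intro q hq
    rcases lt_or_ge q q₁ with h | h
    · exact hgap2 ▸ hgmono ⟨h20, hq₂.2.le⟩ ⟨h20.trans hq.1, h.le⟩ hq.1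
    · exact hgp q ⟨h, hq.2⟩
  have hgneg : ∀ q ∈ Ioo Qs q₂, gap n (n / c) q < 0 := fun q hq =>
    hgap2 ▸ hgmono ⟨hs0.trans hq.1, (hq.2.trans hq₂.2).le⟩ ⟨h20, hq₂.2.le⟩ hq.2
  have hH3 : ∀ q ∈ Ioo Qs 1, 0 < H3 n q := fun q hq =>
    hH ▸ H3_strictMonoOn hn2 ⟨hs0, hs1.le⟩ ⟨hs0.trans hq.1, hq.2.le⟩ hq.1
  have hmin1 : ∀ q ∈ Ioo Qs 1, q ≠ q₁ → G1 n (n / c) q₁ < G1 n (n / c) q := fun q hq hne =>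
    unique_min_of_hasDerivAt ⟨hs, h1⟩ (fun x hx => hasDerivAt_G1 hn2 (hs0.trans hx.1))
      (fun x hx => G1_deriv_neg (hs0.trans hx.1) (hlt x ⟨hs0.trans hx.1, hx.2⟩))
      (fun x hx => G1_deriv_pos (h0.trans hx.1) (hgt x hx)) hq hne
  have hmin2 : ∀ q ∈ Ioo Qs 1, q ≠ q₂ →
      G2 n (n / c) q₂ / H2 n q₂ < G2 n (n / c) q / H2 n q := fun q hq hne =>
    unique_min_of_hasDerivAt (f := fun x => G2 n (n / c) x / H2 n x) ⟨hq₂.1, h21⟩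
      (fun x hx => hasDerivAt_G2_div_H2 hn2 (hs0.trans hx.1) hx.2)
      (fun x hx => div_neg_of_neg_of_pos
        (mul_neg_of_pos_of_neg (Real.rpow_pos_of_pos (hs0.trans hx.1) n) (hgneg x hx))
        (sq_pos_of_neg (H2_neg hn2 (hs0.trans hx.1) (hx.2.trans h21))))
      (fun x hx => div_pos
        (mul_pos (Real.rpow_pos_of_pos (h20.trans hx.1) n) (hgpos x hx))
        (sq_pos_of_neg (H2_neg hn2 (h20.trans hx.1) hx.2))) hq hne
  have hH3' : ∀ x ∈ Ioo Qs 1, 0 < -n * H2 n x / (x ^ n * x ^ 2) := by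
    intro x hx
    have hx0 := hs0.trans hx.1
    have := Real.rpow_pos_of_pos hx0 n
    exact div_pos (mul_pos_of_neg_of_neg (by linarith) (H2_neg hn2 hx0 hx.2)) (by positivity)
  have hmin3 : ∀ q ∈ Ioo Qs 1, q ≠ q₃ →
      G3 n (n / c) q₃ / H3 n q₃ < G3 n (n / c) q / H3 n q := fun q hq hne =>
    unique_min_of_hasDerivAt (f := fun x => G3 n (n / c) x / H3 n x) hq₃
      (fun x hx => hasDerivAt_G3_div_H3 hn2 (hs0.trans hx.1) hx.2 (hH3 x hx).ne')
      (fun x hx => by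
        have hx' : x ∈ Ioo Qs 1 := ⟨hx.1, hx.2.trans hq₃.2⟩
        exact div_neg_of_neg_of_pos (mul_neg_of_pos_of_neg (hH3' x hx') (hneg3 x hx))
          (pow_pos (hH3 x hx') 2))
      (fun x hx => by
        have hx' : x ∈ Ioo Qs 1 := ⟨hq₃.1.trans hx.1, hx.2⟩
        exact div_pos (mul_pos (hH3' x hx') (hpos3 x hx)) (pow_pos (hH3 x hx') 2)) hq hne
  have heq12 : G1 n (n / c) q₂ = G2 n (n / c) q₂ / H2 n q₂ := by
    rw [eq_div_iff (H2_neg hn2 h20 h21).ne]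
    exact sub_eq_zero.1 hgap2
  have hlt31 : G3 n (n / c) q₃ / H3 n q₃ < G1 n (n / c) q₁ := by
    have hle : G3 n (n / c) q₃ / H3 n q₃ ≤ G3 n (n / c) q₁ / H3 n q₁ := by
      rcases eq_or_ne q₁ q₃ with h | h
      · rw [h]
      · exact (hmin3 q₁ ⟨hs, h1⟩ h).le
    refine hle.trans_lt ?_
    rw [div_lt_iff₀ (hH3 q₁ ⟨hs, h1⟩)]
    have hg := G3_lt hn2 h0 h1 fun q hq => hgp q ⟨hq.1.le, hq.2⟩
    have hlt12 := G1_lt_G2_div_H2 hn2 h0 h1 (hgp q₁ ⟨le_rfl, h1⟩)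
    nlinarith [H3_lt_one hn2 h0 h1]
  have hneg : G2 n (n / c) q₁ / H2 n q₁ < 0 := by
    refine div_neg_of_pos_of_neg ?_ (H2_neg hn2 h0 h1)
    have hG1 : ∀ q ∈ Ioo q₁ 1, G1 n (n / c) q < 0 := by
      intro q hq
      rw [← G1_one (n := n) (k := n / c)]
      exact strictMonoOn_of_hasDerivAt_pos (convex_Icc q₁ 1)
        (fun x hx => hasDerivAt_G1 hn2 (h0.trans_le hx.1)) (fun x hx => by
          rw [interior_Icc] at hx
          exact G1_deriv_pos (h0.trans hx.1) (hgt x hx)) ⟨hq.1.le, hq.2.le⟩ ⟨h1.le, le_rfl⟩ hq.2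
    rw [← G2_one (n := n) (k := n / c)]
    exact strictAntiOn_of_hasDerivAt_neg (convex_Icc q₁ 1)
      (fun x hx => hasDerivAt_G2 hn2 (h0.trans_le hx.1)) (fun x hx => by
        rw [interior_Icc] at hx
        exact mul_neg_of_neg_of_pos (hG1 x hx) (Real.rpow_pos_of_pos (h0.trans hx.1) n))
      ⟨le_rfl, h1.le⟩ ⟨h1.le, le_rfl⟩ h1
  have unique_min : ∀ (m f : ℝ → ℝ) (p : ℝ), p ∈ Ioo Qs 1 →
      (∀ q, 0 < q → m q = f q / d) → (∀ q ∈ Ioo Qs 1, q ≠ p → f p < f q) →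
      ∀ q ∈ Ioo Qs 1, m p ≤ m q ∧ (m q = m p → q = p) := by
    intro m f p hp hm hmin q hq
    rw [hm p (hs0.trans hp.1), hm q (hs0.trans hq.1)]
    by_cases hne : q = p
    · simp [hne]
    · have := div_lt_div_of_pos_right (hmin q hq hne) hd
      exact ⟨this.le, fun h => absurd h this.ne'⟩
  refine ⟨q₁, q₂, q₃, ⟨hs, h1⟩, ⟨hq₂.1, h21⟩, hq₃,
    unique_min _ _ q₁ ⟨hs, h1⟩ (fun q hq => mu1_eq hq) hmin1,
    unique_min _ (fun x => G2 n (n / c) x / H2 n x) q₂ ⟨hq₂.1, h21⟩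
      (fun q hq => mu2_eq hn2 hq) hmin2,
    unique_min _ (fun x => G3 n (n / c) x / H3 n x) q₃ hq₃ (fun q hq => mu3_eq hn2 hq) hmin3,
    hq₁, hq₂.2, ?_, ?_, ?_, ?_⟩
  · rw [mu1_eq h20, mu2_eq hn2 h20, heq12]
  · rw [mu1_eq h0, mu3_eq hn2 (hs0.trans hq₃.1)]
    exact div_lt_div_of_pos_right hlt31 hd
  · rw [mu1_eq h0, mu2_eq hn2 h20, ← heq12]
    exact div_lt_div_of_pos_right (hmin1 q₂ ⟨hq₂.1, h21⟩ hq₂.2.ne) hd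
  · rw [mu2_eq hn2 h20]
    exact div_neg_of_neg_of_pos ((hmin2 q₁ ⟨hs, h1⟩ hq₂.2.ne').trans hneg) hd
end
end

section
/- Suppose d > 0, n ∈ [2,3], and c ∈ [1.55, n). Then μ₃(Q) < μ₁(Q) for every Q ∈ (Q₂, 1), where Q₂ ∈ (Q_*, 1) is the unique global minimizer of μ₂ on (Q_*, 1). -/
open Set Filter Topology intervalIntegral Real

noncomputable section

/-- The weight integral `∫₁^Q qⁿ dq`, so that `h₂ = d * weightIntegral`. -/
def weightIntegral (n Q : ℝ) : ℝ := ∫ q in (1:ℝ)..Q, q ^ n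

/-- `F₂(Q, μ₁(Q))`, whose sign is that of `μ₂ - μ₁` and of `μ₂'`. -/
def F2AtMu1 (d n c Q : ℝ) : ℝ := F2 d n c Q 0 - F1 d n c Q 0 * weightIntegral n Q

lemma F1_eq_add (d n c Q μ : ℝ) : F1 d n c Q μ = F1 d n c Q 0 + μ * d := by
  simp [F1]

lemma mu1_eq_div (d n c Q : ℝ) : mu1 d n c Q = -(F1 d n c Q 0) / d := by
  rw [mu1, F1_eq_add d n c Q 1]; ring_nf

lemma hasDerivAt_integral_one_of_continuousOn {f : ℝ → ℝ} (hf : ContinuousOn f (Ioi 0))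
    {Q : ℝ} (hQ : 0 < Q) : HasDerivAt (fun x => ∫ q in (1:ℝ)..x, f q) (f Q) Q := by
  have hsub : uIcc 1 Q ⊆ Ioi 0 := fun x hx => lt_of_lt_of_le (lt_min one_pos hQ) hx.1
  exact integral_hasDerivAt_right (hf.mono hsub).intervalIntegrable
    (hf.stronglyMeasurableAtFilter isOpen_Ioi Q hQ) (hf.continuousAt (Ioi_mem_nhds hQ))

lemma intervalIntegrable_one_of_continuousOn {f : ℝ → ℝ} (hf : ContinuousOn f (Ioi 0))
    {Q : ℝ} (hQ : 0 < Q) : IntervalIntegrable f MeasureTheory.volume 1 Q :=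
  (hf.mono fun _ hx => lt_of_lt_of_le (lt_min one_pos hQ) hx.1).intervalIntegrable

lemma continuousOn_rpow_const_Ioi (p : ℝ) : ContinuousOn (fun q : ℝ => q ^ p) (Ioi 0) :=
  fun _ hq => (continuousAt_rpow_const _ _ (Or.inl (ne_of_gt hq))).continuousWithinAt

lemma hasDerivAt_F1 {d n c Q : ℝ} (hn : 1 < n) (hQ : 0 < Q) (μ : ℝ) :
    HasDerivAt (fun q => F1 d n c q μ) (Q ^ (-n) * (1 - n / c * Q ^ (n - 1))) Q := by
  have h1 := (((hasDerivAt_rpow_const (p := 1 - n) (Or.inl hQ.ne')).sub_const 1).const_mul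
    (-(1 / (n - 1))))
  have h2 := (hasDerivAt_log hQ.ne').const_mul (n / c)
  refine ((h1.sub h2).add_const (μ * d)).congr_deriv ?_
  have hn' : n - 1 ≠ 0 := by linarith
  have e1 : Q ^ (1 - n - 1) = Q ^ (-n) := by ring_nf
  have e2 : Q⁻¹ = Q ^ (-n) * Q ^ (n - 1) := by
    rw [← rpow_add hQ, ← rpow_neg_one]; ring_nf
  rw [e1, e2]
  field_simp
  ring

lemma continuousOn_F1_mul_rpow {d n c : ℝ} (hn : 1 < n) (μ : ℝ) :
    ContinuousOn (fun q => F1 d n c q μ * q ^ n) (Ioi 0) :=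
  ContinuousOn.mul (fun _ hq => (hasDerivAt_F1 hn hq μ).continuousAt.continuousWithinAt)
    (continuousOn_rpow_const_Ioi n)

lemma hasDerivAt_F2 {d n c Q : ℝ} (hn : 1 < n) (hQ : 0 < Q) (μ : ℝ) :
    HasDerivAt (fun q => F2 d n c q μ) (F1 d n c Q μ * Q ^ n) Q :=
  hasDerivAt_integral_one_of_continuousOn (continuousOn_F1_mul_rpow hn μ) hQ

lemma continuousOn_F2_mul_rpow {d n c : ℝ} (hn : 1 < n) (μ : ℝ) :
    ContinuousOn (fun q => F2 d n c q μ * q ^ (-(n + 2))) (Ioi 0) :=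
  ContinuousOn.mul (fun _ hq => (hasDerivAt_F2 hn hq μ).continuousAt.continuousWithinAt)
    (continuousOn_rpow_const_Ioi _)

lemma hasDerivAt_weightIntegral {n Q : ℝ} (hQ : 0 < Q) :
    HasDerivAt (weightIntegral n) (Q ^ n) Q :=
  hasDerivAt_integral_one_of_continuousOn (continuousOn_rpow_const_Ioi n) hQ

lemma weightIntegral_neg {n Q : ℝ} (hQ : Q ∈ Ioo (0:ℝ) 1) : weightIntegral n Q < 0 := by
  rw [weightIntegral, integral_symm, neg_lt_zero]
  exact intervalIntegral_pos_of_pos_on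
    (intervalIntegrable_one_of_continuousOn (continuousOn_rpow_const_Ioi n) hQ.1).symm
    (fun x hx => rpow_pos_of_pos (hQ.1.trans hx.1) n) hQ.2

lemma F2_eq_add {d n c Q : ℝ} (hn : 1 < n) (hQ : 0 < Q) (μ : ℝ) :
    F2 d n c Q μ = F2 d n c Q 0 + μ * (d * weightIntegral n Q) := by
  have h0 := intervalIntegrable_one_of_continuousOn
    (continuousOn_F1_mul_rpow (d := d) (c := c) hn 0) hQ
  have h1 := intervalIntegrable_one_of_continuousOn (continuousOn_rpow_const_Ioi n) hQ
  rw [F2, F2, weightIntegral, ← mul_assoc, ← integral_const_mul,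
    ← integral_add h0 (h1.const_mul _)]
  congr 1 with q
  rw [F1_eq_add]
  ring

lemma F2_one_sub_F2_zero {d n c Q : ℝ} (hn : 1 < n) (hQ : 0 < Q) :
    F2 d n c Q 1 - F2 d n c Q 0 = d * weightIntegral n Q := by
  rw [F2_eq_add hn hQ 1]; ring

lemma F3_eq_add {d n c Q : ℝ} (hn : 1 < n) (hQ : 0 < Q) (μ : ℝ) :
    F3 d n c Q μ = F3 d n c Q 0 + μ * (F3 d n c Q 1 - F3 d n c Q 0) := by
  have hi := fun ν : ℝ => intervalIntegrable_one_of_continuousOn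
    (continuousOn_F2_mul_rpow (d := d) (c := c) hn ν) hQ
  have key : ∫ q in (1:ℝ)..Q, F2 d n c q μ * q ^ (-(n + 2)) =
      (∫ q in (1:ℝ)..Q, F2 d n c q 0 * q ^ (-(n + 2))) +
        μ * ((∫ q in (1:ℝ)..Q, F2 d n c q 1 * q ^ (-(n + 2))) -
          ∫ q in (1:ℝ)..Q, F2 d n c q 0 * q ^ (-(n + 2))) := by
    rw [← integral_sub (hi 1) (hi 0), ← integral_const_mul,
      ← integral_add (hi 0) (((hi 1).sub (hi 0)).const_mul _)]
    refine integral_congr fun q hq => ?_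
    have hq0 : 0 < q := lt_of_lt_of_le (lt_min one_pos hQ) hq.1
    simp only [F2_eq_add hn hq0 μ, F2_eq_add hn hq0 1]
    ring
  simp only [F3]
  rw [key, F1_eq_add d n c Q μ, F1_eq_add d n c Q 1]
  ring

lemma hasDerivAt_F3 {d n c Q : ℝ} (hn : 1 < n) (hQ : 0 < Q) (μ : ℝ) :
    HasDerivAt (fun q => F3 d n c q μ)
      (Q ^ (-n) * (1 - n / c * Q ^ (n - 1)) - n * (F2 d n c Q μ * Q ^ (-(n + 2)))) Q :=
  (hasDerivAt_F1 hn hQ μ).sub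
    ((hasDerivAt_integral_one_of_continuousOn (continuousOn_F2_mul_rpow hn μ) hQ).const_mul n)

/-- `h₃` is strictly increasing on `(0, 1]`. -/
lemma strictMonoOn_F3_one_sub_F3_zero {d n c : ℝ} (hd : 0 < d) (hn : 1 < n) :
    StrictMonoOn (fun q => F3 d n c q 1 - F3 d n c q 0) (Ioc 0 1) := by
  have hder : ∀ q : ℝ, 0 < q → HasDerivAt (fun q => F3 d n c q 1 - F3 d n c q 0)
      (-(n * (d * weightIntegral n q * q ^ (-(n + 2))))) q := fun q hq => by
    refine ((hasDerivAt_F3 hn hq 1).sub (hasDerivAt_F3 hn hq 0)).congr_deriv ?_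
    rw [← F2_one_sub_F2_zero (c := c) hn hq]
    ring
  refine strictMonoOn_of_deriv_pos (convex_Ioc 0 1)
    (fun q hq => (hder q hq.1).continuousAt.continuousWithinAt) fun q hq => ?_
  rw [interior_Ioc] at hq
  rw [(hder q hq.1).deriv, neg_pos]
  exact mul_neg_of_pos_of_neg (by linarith) (mul_neg_of_neg_of_pos
    (mul_neg_of_pos_of_neg hd (weightIntegral_neg hq)) (rpow_pos_of_pos hq.1 _))

lemma hasDerivAt_F2AtMu1 {d n c Q : ℝ} (hn : 1 < n) (hQ : 0 < Q) :
    HasDerivAt (F2AtMu1 d n c)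
      (-(Q ^ (-n) * (1 - n / c * Q ^ (n - 1)) * weightIntegral n Q)) Q := by
  refine ((hasDerivAt_F2 hn hQ 0).sub
    ((hasDerivAt_F1 hn hQ 0).mul (hasDerivAt_weightIntegral hQ))).congr_deriv ?_
  ring

lemma hasDerivAt_mu2 {d n c Q : ℝ} (hd : 0 < d) (hn : 1 < n) (hQ : Q ∈ Ioo (0:ℝ) 1) :
    HasDerivAt (mu2 d n c)
      (d * Q ^ n * F2AtMu1 d n c Q / (d * weightIntegral n Q) ^ 2) Q := by
  have hne : d * weightIntegral n Q ≠ 0 := (mul_neg_of_pos_of_neg hd (weightIntegral_neg hQ)).ne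
  have h := (hasDerivAt_F2 (d := d) (c := c) hn hQ.1 0).neg.div
    ((hasDerivAt_weightIntegral (n := n) hQ.1).const_mul d) hne
  refine (h.congr_of_eventuallyEq ?_).congr_deriv ?_
  · filter_upwards [Ioi_mem_nhds hQ.1] with q hq
    rw [mu2, F2_one_sub_F2_zero hn hq]
    rfl
  · rw [F2AtMu1]
    congr 1
    simp only [Pi.neg_apply]
    ring

/-- `F₂(Q, μ₁(Q))` is positive to the right of any of its zeros. -/
lemma F2AtMu1_pos {d n c Q₀ Q : ℝ} (hn : 1 < n) (hc : 0 < c) (hQ₀ : 0 < Q₀)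
    (hzero : F2AtMu1 d n c Q₀ = 0) (hQ : Q ∈ Ioo Q₀ 1) : 0 < F2AtMu1 d n c Q := by
  have hQpos : 0 < Q := hQ₀.trans hQ.1
  have hnc : 0 < n / c := div_pos (by linarith) hc
  rcases le_or_gt 1 (n / c * Q ^ (n - 1)) with hcase | hcase
  · have hanti : StrictAntiOn (F2AtMu1 d n c) (Icc Q 1) := by
      refine strictAntiOn_of_deriv_neg (convex_Icc _ _) (fun q hq =>
        (hasDerivAt_F2AtMu1 hn (hQpos.trans_le hq.1)).continuousAt.continuousWithinAt)
        fun q hq => ?_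
      rw [interior_Icc] at hq
      have hq0 : 0 < q := hQpos.trans hq.1
      have hlt : n / c * Q ^ (n - 1) < n / c * q ^ (n - 1) :=
        mul_lt_mul_of_pos_left (rpow_lt_rpow hQpos.le hq.1 (by linarith)) hnc
      rw [(hasDerivAt_F2AtMu1 hn hq0).deriv, neg_lt_zero]
      exact mul_pos_of_neg_of_neg
        (mul_neg_of_pos_of_neg (rpow_pos_of_pos hq0 _) (by linarith))
        (weightIntegral_neg ⟨hq0, hq.2⟩)
    have h := hanti (left_mem_Icc.2 hQ.2.le) (right_mem_Icc.2 hQ.2.le) hQ.2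
    simpa [F2AtMu1, F2, weightIntegral] using h
  · have hmono : StrictMonoOn (F2AtMu1 d n c) (Icc Q₀ Q) := by
      refine strictMonoOn_of_deriv_pos (convex_Icc _ _) (fun q hq =>
        (hasDerivAt_F2AtMu1 hn (hQ₀.trans_le hq.1)).continuousAt.continuousWithinAt)
        fun q hq => ?_
      rw [interior_Icc] at hq
      have hq0 : 0 < q := hQ₀.trans hq.1
      have hlt : n / c * q ^ (n - 1) < n / c * Q ^ (n - 1) :=
        mul_lt_mul_of_pos_left (rpow_lt_rpow hq0.le hq.2 (by linarith)) hnc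
      rw [(hasDerivAt_F2AtMu1 hn hq0).deriv, neg_pos]
      exact mul_neg_of_pos_of_neg
        (mul_pos (rpow_pos_of_pos hq0 _) (by linarith))
        (weightIntegral_neg ⟨hq0, hq.2.trans hQ.2⟩)
    exact hzero ▸ hmono (left_mem_Icc.2 hQ.1.le) (right_mem_Icc.2 hQ.1.le) hQ.1

lemma F2AtMu1_eq_zero_of_isLocalMin_mu2 {d n c Q : ℝ} (hd : 0 < d) (hn : 1 < n)
    (hQ : Q ∈ Ioo (0:ℝ) 1) (hmin : IsLocalMin (mu2 d n c) Q) : F2AtMu1 d n c Q = 0 := by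
  have h := hmin.hasDerivAt_eq_zero (hasDerivAt_mu2 hd hn hQ)
  have hpow := (rpow_pos_of_pos hQ.1 n).ne'
  have hw := (weightIntegral_neg (n := n) hQ).ne
  simpa [hd.ne', hpow, hw] using h

/-- If `F₂(q, μ₁(q)) > 0` on `[Q, 1)`, then `F₂(q, μ₁(Q)) > 0` there as well, since `μ₂`
increases on `[Q, 1)` from a value above `μ₁(Q)`. -/
lemma F2_mu1_pos {d n c Q q : ℝ} (hd : 0 < d) (hn : 1 < n) (hQ : 0 < Q)
    (hpos : ∀ s ∈ Ico Q 1, 0 < F2AtMu1 d n c s) (hq : q ∈ Ico Q 1) :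
    0 < F2 d n c q (mu1 d n c Q) := by
  have hmono : StrictMonoOn (mu2 d n c) (Ico Q 1) := by
    refine strictMonoOn_of_deriv_pos (convex_Ico _ _) (fun s hs =>
      (hasDerivAt_mu2 hd hn ⟨hQ.trans_le hs.1, hs.2⟩).continuousAt.continuousWithinAt)
      fun s hs => ?_
    rw [interior_Ico] at hs
    have hs' : s ∈ Ioo (0:ℝ) 1 := ⟨hQ.trans hs.1, hs.2⟩
    rw [(hasDerivAt_mu2 hd hn hs').deriv]
    exact div_pos (mul_pos (mul_pos hd (rpow_pos_of_pos hs'.1 n)) (hpos s ⟨hs.1.le, hs.2⟩))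
      (sq_pos_of_neg (mul_neg_of_pos_of_neg hd (weightIntegral_neg hs')))
  have hF2 : ∀ s ∈ Ico Q 1, ∀ μ, F2 d n c s μ = (d * weightIntegral n s) * (μ - mu2 d n c s) :=
    fun s hs μ => by
      have hs' : s ∈ Ioo (0:ℝ) 1 := ⟨hQ.trans_le hs.1, hs.2⟩
      have hw := (weightIntegral_neg (n := n) hs').ne
      rw [mu2, F2_one_sub_F2_zero hn hs'.1, F2_eq_add hn hs'.1 μ]
      field_simp
      ring
  have hQmem : Q ∈ Ico Q 1 := ⟨le_rfl, hq.1.trans_lt hq.2⟩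
  have hneg : ∀ s ∈ Ico Q 1, d * weightIntegral n s < 0 := fun s hs =>
    mul_neg_of_pos_of_neg hd (weightIntegral_neg ⟨hQ.trans_le hs.1, hs.2⟩)
  have hbase : mu1 d n c Q < mu2 d n c Q := by
    have h : 0 < F2 d n c Q (mu1 d n c Q) := by
      convert hpos Q hQmem using 1
      rw [F2_eq_add hn hQ, F2AtMu1, mu1_eq_div]
      field_simp
      ring
    rw [hF2 Q hQmem] at h
    linarith [neg_of_mul_pos_right h (hneg Q hQmem).le]
  rw [hF2 q hq]
  exact mul_pos_of_neg_of_neg (hneg q hq)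
    (sub_neg.2 (hbase.trans_le (hmono.monotoneOn hQmem hq hq.1)))

/-- μ₃ < μ₁ on (Q₂, 1) (Lemma on μᵢ properties, item (4)). -/
theorem magma_mu3_lt_mu1
    (d n c Qs Q2 : ℝ) (hd : 0 < d) (hn : n ∈ Icc (2:ℝ) 3) (hc : c ∈ Ico (1.55:ℝ) n)
    (hQs : Qs ∈ Ioo (0:ℝ) 1) (hQsz : F3 d n c Qs 1 - F3 d n c Qs 0 = 0)
    (hQsu : ∀ Q ∈ Ioo (0:ℝ) 1, F3 d n c Q 1 - F3 d n c Q 0 = 0 → Q = Qs)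
    (hQ2 : Q2 ∈ Ioo Qs 1)
    (hQ2min : ∀ Q ∈ Ioo Qs (1:ℝ), mu2 d n c Q2 ≤ mu2 d n c Q)
    (hQ2uniq : ∀ Q ∈ Ioo Qs (1:ℝ), mu2 d n c Q = mu2 d n c Q2 → Q = Q2) :
    ∀ Q ∈ Ioo Q2 (1:ℝ), mu3 d n c Q < mu1 d n c Q := by
  intro Q hQ
  have hn1 : 1 < n := by linarith [hn.1]
  have hc0 : 0 < c := lt_of_lt_of_le (by norm_num) hc.1
  have hQ20 : 0 < Q2 := hQs.1.trans hQ2.1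
  have hQ0 : 0 < Q := hQ20.trans hQ.1
  have hmin : IsLocalMin (mu2 d n c) Q2 := by
    filter_upwards [Ioo_mem_nhds hQ2.1 hQ2.2] with q hq using hQ2min q hq
  have hzero := F2AtMu1_eq_zero_of_isLocalMin_mu2 hd hn1 ⟨hQ20, hQ2.2⟩ hmin
  have hF2 : ∀ q ∈ Ico Q 1, 0 < F2 d n c q (mu1 d n c Q) := fun q hq =>
    F2_mu1_pos hd hn1 hQ0 (fun s hs =>
      F2AtMu1_pos hn1 hc0 hQ20 hzero ⟨hQ.1.trans_le hs.1, hs.2⟩) hq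
  have hint : 0 < ∫ q in Q..1, F2 d n c q (mu1 d n c Q) * q ^ (-(n + 2)) :=
    intervalIntegral_pos_of_pos_on
      (intervalIntegrable_one_of_continuousOn (continuousOn_F2_mul_rpow hn1 _) hQ0).symm
      (fun q hq => mul_pos (hF2 q ⟨hq.1.le, hq.2⟩) (rpow_pos_of_pos (hQ0.trans hq.1) _)) hQ.2
  have hF1 : F1 d n c Q (mu1 d n c Q) = 0 := by
    rw [F1_eq_add, mu1_eq_div, div_mul_cancel₀ _ hd.ne', add_neg_cancel]
  have hF3 : 0 < F3 d n c Q (mu1 d n c Q) := by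
    rw [F3, hF1, integral_symm]
    linarith [mul_pos (zero_lt_one.trans hn1) hint]
  have hh3 : 0 < F3 d n c Q 1 - F3 d n c Q 0 := by
    have h := strictMonoOn_F3_one_sub_F3_zero (c := c) hd hn1 ⟨hQs.1, hQs.2.le⟩
      ⟨hQ0, hQ.2.le⟩ (hQ2.1.trans hQ.1)
    simpa only [hQsz] using h
  rw [F3_eq_add hn1 hQ0] at hF3
  rw [mu3, div_lt_iff₀ hh3]
  linarith
end
end
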